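/- arXiv:1001.3195 — 2 statements merged into one kernel-verified Lean document; each statement's English description precedes it below -/
import Mathlib

section
/- Let m ≥ 3. A matrix Σ = (σ_ij) ∈ S⪰0^m(C_m) lies in the image of φ_{C_m} if and only if Σ_{M ∈ M(C_m)} (−1)^{|M|} ∏_{{i,j}∈M} σ_ij² ∏_{i ∈ [m]∖M} σ_ii ≥ 2 ∏_{i=1}^m |σ_{i,i+1}|, where the sum is over all matchings M of C_m and indices are read modulo m so that σ_{m,m+1} = σ_{1m}. -/
open Matrix

/-- `Δ` is a simplicial complex with ground set all of `V`: it is closed under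
taking subsets and every vertex lies in some face. -/
def IsSimplicialComplex {V : Type*} [Fintype V] [DecidableEq V]
    (Δ : Finset (Finset V)) : Prop :=
  (∀ F ∈ Δ, ∀ F', F' ⊆ F → F' ∈ Δ) ∧ ∀ i : V, ∃ F ∈ Δ, i ∈ F

/-- The parametrization `φ_Δ`, sending `γ = (γ_{i,F})` to the matrix with entries
`φ_Δ(γ)_{ij} = ∑_{F ∈ Δ : i,j ∈ F} γ_{i,F} γ_{j,F}`. -/
def phi {V : Type*} [Fintype V] [DecidableEq V] (Δ : Finset (Finset V))
    (γ : Finset V → V → ℝ) : Matrix V V ℝ :=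
  Matrix.of fun i j => ∑ F ∈ Δ, if i ∈ F ∧ j ∈ F then γ F i * γ F j else 0

/-- The image of the parametrization `φ_Δ`. -/
def phiImage {V : Type*} [Fintype V] [DecidableEq V] (Δ : Finset (Finset V)) :
    Set (Matrix V V ℝ) :=
  Set.range (phi Δ)

/-- The edge complex of the cycle `C_m`, with faces the empty set, the
singletons, and the edges `{i, i+1}` (indices modulo `m`). -/
def cycleComplex (m : ℕ) [NeZero m] : Finset (Finset (Fin m)) :=
  {∅} ∪ Finset.univ.image (fun i : Fin m => ({i} : Finset (Fin m))) ∪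
    Finset.univ.image (fun i : Fin m => ({i, i + 1} : Finset (Fin m)))

/-- The cone `S⪰0^m(C_m)` of positive semidefinite matrices with zeros at the
non-edges of the cycle `C_m`. -/
def cyclePSDCone (m : ℕ) [NeZero m] : Set (Matrix (Fin m) (Fin m) ℝ) :=
  {S | S.PosSemidef ∧
    ∀ i j : Fin m, i ≠ j → j ≠ i + 1 → i ≠ j + 1 → S i j = 0}

/-- The matchings of the cycle `C_m`: sets of pairwise disjoint edges, where
the edge indexed by `i : Fin m` is `{i, i+1}` (indices modulo `m`). -/
def cycleMatchings (m : ℕ) [NeZero m] : Finset (Finset (Fin m)) :=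
  Finset.univ.filter fun M => ∀ i ∈ M, ∀ j ∈ M, i ≠ j →
    ({i, i + 1} ∩ {j, j + 1} : Finset (Fin m)) = ∅

/-- The matching-expansion term
`∑_{M ∈ M(C_m)} (−1)^{|M|} ∏_{{i,j} ∈ M} σ_ij² ∏_{i ∈ [m]∖M} σ_ii`,
where `[m] ∖ M` is the set of vertices not covered by the matching `M`. -/
noncomputable def matchingSum {m : ℕ} [NeZero m]
    (S : Matrix (Fin m) (Fin m) ℝ) : ℝ :=
  ∑ M ∈ cycleMatchings m, (-1 : ℝ) ^ M.card *
    (∏ i ∈ M, (S i (i + 1)) ^ 2) *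
    ∏ i ∈ (M.biUnion fun i => {i, i + 1})ᶜ, S i i

section FinCycle

variable {m : ℕ} [NeZero m]

theorem Fin.add_one_ne_self_of_three_le (hm : 3 ≤ m) (i : Fin m) : i + 1 ≠ i := by
  intro h
  have h1 : (1 : Fin m) = 0 := by simpa using h
  have := congrArg Fin.val h1
  simp [Nat.mod_eq_of_lt (show 1 < m by omega)] at this

theorem Fin.add_one_add_one_ne_self_of_three_le (hm : 3 ≤ m) (i : Fin m) : i + 1 + 1 ≠ i := by
  intro h
  have h1 : (1 + 1 : Fin m) = 0 := by rw [add_assoc] at h; simpa using h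
  have := congrArg Fin.val h1
  simp [Fin.val_add, Nat.mod_eq_of_lt (show 1 < m by omega),
    Nat.mod_eq_of_lt (show 2 < m by omega)] at this

theorem Fin.forall_of_imp_add_one {p : Fin m → Prop} (h : ∀ i, p i → p (i + 1)) {i : Fin m}
    (hi : p i) (j : Fin m) : p j := by
  have key : ∀ n : ℕ, p (i + Fin.ofNat m n) := by
    intro n
    induction n with
    | zero => simpa using hi
    | succ n ih =>
      have := h _ ih
      rwa [add_assoc, show Fin.ofNat m n + 1 = Fin.ofNat m (n + 1) by
        ext; simp [Fin.val_add]] at this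
  have := key (j - i).val
  simpa using this

theorem mem_cycleMatchings_iff (hm : 3 ≤ m) (M : Finset (Fin m)) :
    M ∈ cycleMatchings m ↔ ∀ i ∈ M, i + 1 ∉ M := by
  simp only [cycleMatchings, Finset.mem_filter, Finset.mem_univ, true_and]
  constructor
  · intro h i hi hi'
    have := h i hi (i + 1) hi' (Fin.add_one_ne_self_of_three_le hm i).symm
    have h2 : i + 1 ∈ ({i, i + 1} ∩ {i + 1, i + 1 + 1} : Finset (Fin m)) := by simp
    simp [this] at h2
  · intro h i hi j hj hij
    ext k
    simp only [Finset.mem_inter, Finset.mem_insert, Finset.mem_singleton, Finset.notMem_empty,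
      iff_false, not_and, not_or]
    rintro (rfl | rfl)
    · exact ⟨hij, fun e => h j hj (e ▸ hi)⟩
    · exact ⟨fun e => h i hi (e ▸ hj), fun e => hij (add_right_cancel e)⟩

/-- The map exchanging the endpoints of every edge of `M`. -/
def matchingSwap (M : Finset (Fin m)) (i : Fin m) : Fin m :=
  if i ∈ M then i + 1 else if i - 1 ∈ M then i - 1 else i

theorem exists_perm_eq_matchingSwap (hm : 3 ≤ m) (M : Finset (Fin m))
    (hM : ∀ i ∈ M, i + 1 ∉ M) :
    ∃ σ : Equiv.Perm (Fin m), (∀ i, σ i = matchingSwap M i) ∧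
      Equiv.Perm.sign σ = (-1) ^ M.card := by
  induction M using Finset.induction_on with
  | empty => exact ⟨1, by simp [matchingSwap]⟩
  | insert e M he ih =>
    obtain ⟨σ, hσ, hs⟩ := ih fun i hi h =>
      hM i (Finset.mem_insert_of_mem hi) (Finset.mem_insert_of_mem h)
    refine ⟨Equiv.swap e (e + 1) * σ, fun i => ?_, ?_⟩
    · have e1 := Fin.add_one_ne_self_of_three_le hm e
      have h1 : e + 1 ∉ M := fun h => hM e (by simp) (by simp [h])
      have h2 : e - 1 ∉ M := fun h => hM (e - 1) (by simp [h]) (by simp)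
      rw [Equiv.Perm.mul_apply, hσ]
      simp only [matchingSwap, Finset.mem_insert]
      by_cases hi : i = e
      · subst hi; simp [he, h2]
      by_cases hi' : i = e + 1
      · subst hi'; simp [he, h1, e1]
      have hi'' : i - 1 ≠ e := fun h => hi' (by rw [← h]; simp)
      simp only [hi, hi'', false_or]
      split_ifs with h3 h4
      · refine Equiv.swap_apply_of_ne_of_ne (fun h => ?_) (fun h => hi (add_right_cancel h))
        exact h2 (by rw [← h]; simpa using h3)
      · refine Equiv.swap_apply_of_ne_of_ne hi'' (fun h => h1 (by rwa [← h]))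
      · exact Equiv.swap_apply_of_ne_of_ne hi hi'
    · rw [Equiv.Perm.sign_mul, hs,
        Equiv.Perm.sign_swap (Fin.add_one_ne_self_of_three_le hm e).symm,
        Finset.card_insert_of_notMem he, pow_succ']

theorem prod_matchingSwap {R : Type*} [CommRing R] (A : Matrix (Fin m) (Fin m) R)
    (hA : ∀ i j, A i j = A j i) (M : Finset (Fin m)) (hM : ∀ i ∈ M, i + 1 ∉ M) :
    ∏ i, A (matchingSwap M i) i =
      (∏ i ∈ M, A i (i + 1) ^ 2) * ∏ i ∈ (M.biUnion fun i => {i, i + 1})ᶜ, A i i := by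
  have hU : M.biUnion (fun i => {i, i + 1}) = M ∪ M.image (· + 1) := by
    ext k; simp only [Finset.mem_biUnion, Finset.mem_insert, Finset.mem_singleton,
      Finset.mem_union, Finset.mem_image]
    constructor
    · rintro ⟨i, hi, rfl | rfl⟩
      · exact Or.inl hi
      · exact Or.inr ⟨i, hi, rfl⟩
    · rintro (h | ⟨i, hi, rfl⟩)
      · exact ⟨k, h, Or.inl rfl⟩
      · exact ⟨i, hi, Or.inr rfl⟩
  have hd : Disjoint M (M.image (· + 1)) := by
    rw [Finset.disjoint_right]
    intro k hk
    obtain ⟨i, hi, rfl⟩ := Finset.mem_image.1 hk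
    exact hM i hi
  rw [hU, ← Finset.prod_mul_prod_compl (M ∪ M.image (· + 1)), Finset.prod_union hd,
    Finset.prod_image (fun a _ b _ h => add_right_cancel h), ← Finset.prod_mul_distrib]
  congr 1
  · refine Finset.prod_congr rfl fun i hi => ?_
    simp [matchingSwap, hi, hM i hi, hA (i + 1) i, sq]
  · refine Finset.prod_congr rfl fun i hi => ?_
    simp only [Finset.mem_compl, Finset.mem_union, Finset.mem_image, not_or, not_exists,
      not_and] at hi
    have : i - 1 ∉ M := fun h => hi.2 _ h (by simp)
    simp [matchingSwap, hi.1, this]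

theorem perm_eq_matchingSwap (σ : Equiv.Perm (Fin m))
    (h : ∀ i, σ i = i ∨ σ i = i + 1 ∨ i = σ i + 1)
    (hσ : ∀ i, σ i = i + 1 ↔ σ (i + 1) = i) (i : Fin m) :
    σ i = matchingSwap (Finset.univ.filter fun i => σ i = i + 1) i := by
  simp only [matchingSwap, Finset.mem_filter, Finset.mem_univ, true_and]
  split_ifs with h1 h2
  · exact h1
  · simpa using (hσ _).1 h2
  · rcases h i with h3 | h3 | h3
    · exact h3
    · exact absurd h3 h1
    · have h4 : i - 1 = σ i := sub_eq_of_eq_add h3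
      exact absurd ((hσ (i - 1)).2 (by simpa using h4.symm)) h2

/-- A permutation moving each vertex of the cycle to itself or to a neighbour, with an edge
traversed in the positive direction only, is the rotation. -/
theorem perm_eq_rotation (hm : 3 ≤ m) (σ : Equiv.Perm (Fin m))
    (h : ∀ i, σ i = i ∨ σ i = i + 1 ∨ i = σ i + 1)
    {i : Fin m} (hi : σ i = i + 1) (hi' : σ (i + 1) ≠ i) (j : Fin m) : σ j = j + 1 := by
  have step : ∀ i, σ i = i + 1 ∧ σ (i + 1) ≠ i →
      σ (i + 1) = i + 1 + 1 ∧ σ (i + 1 + 1) ≠ i + 1 := by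
    rintro i ⟨h1, h2⟩
    refine ⟨?_, fun h3 => ?_⟩
    · rcases h (i + 1) with h3 | h3 | h3
      · exact absurd (σ.injective (h3.trans h1.symm)) (Fin.add_one_ne_self_of_three_le hm i)
      · exact h3
      · exact absurd (add_right_cancel h3).symm h2
    · exact Fin.add_one_add_one_ne_self_of_three_le hm i (σ.injective (h3.trans h1.symm))
  exact (Fin.forall_of_imp_add_one (p := fun i => σ i = i + 1 ∧ σ (i + 1) ≠ i) step ⟨hi, hi'⟩ j).1

theorem apply_inv_eq_self_or_neighbour {σ : Equiv.Perm (Fin m)}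
    (h : ∀ i, σ i = i ∨ σ i = i + 1 ∨ i = σ i + 1) (i : Fin m) :
    σ⁻¹ i = i ∨ σ⁻¹ i = i + 1 ∨ i = σ⁻¹ i + 1 := by
  have := h (σ⁻¹ i)
  rw [show σ (σ⁻¹ i) = i from σ.apply_symm_apply i] at this
  exact this.imp Eq.symm Or.symm

theorem rotation_or_inv_or_involutive (hm : 3 ≤ m) (σ : Equiv.Perm (Fin m))
    (h : ∀ i, σ i = i ∨ σ i = i + 1 ∨ i = σ i + 1) :
    σ = finRotate m ∨ σ = (finRotate m)⁻¹ ∨ ∀ i, σ i = i + 1 ↔ σ (i + 1) = i := by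
  by_contra! hc
  obtain ⟨h1, h2, i, ⟨h3, h4⟩ | ⟨h3, h4⟩⟩ := hc
  · exact h1 (Equiv.ext fun j => by
      rw [perm_eq_rotation hm σ h h3 h4 j, finRotate_apply])
  · refine h2 (inv_eq_iff_eq_inv.1 (Equiv.ext fun j => ?_))
    rw [perm_eq_rotation hm σ⁻¹ (apply_inv_eq_self_or_neighbour h) (i := i), finRotate_apply]
    · rw [Equiv.Perm.inv_eq_iff_eq, h4]
    · rw [Ne, Equiv.Perm.inv_eq_iff_eq]
      exact fun e => h3 e.symm

theorem sum_involutive_eq_matchingSum (hm : 3 ≤ m) (A : Matrix (Fin m) (Fin m) ℝ)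
    (hA : ∀ i j, A i j = A j i) :
    ∑ σ : Equiv.Perm (Fin m) with (∀ i, σ i = i ∨ σ i = i + 1 ∨ i = σ i + 1) ∧
      (∀ i, σ i = i + 1 ↔ σ (i + 1) = i), Equiv.Perm.sign σ • ∏ i, A (σ i) i =
    matchingSum A := by
  have hmatch : ∀ σ : Equiv.Perm (Fin m), (∀ i, σ i = i + 1 ↔ σ (i + 1) = i) →
      ∀ i ∈ Finset.univ.filter (fun i => σ i = i + 1),
        i + 1 ∉ Finset.univ.filter (fun i => σ i = i + 1) := by
    intro σ hσ i hi hi'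
    simp only [Finset.mem_filter, Finset.mem_univ, true_and] at hi hi'
    rw [(hσ i).1 hi] at hi'
    exact Fin.add_one_add_one_ne_self_of_three_le hm i hi'.symm
  refine Finset.sum_bij (fun σ _ => Finset.univ.filter fun i => σ i = i + 1) ?_ ?_ ?_ ?_
  · intro σ hσ
    simp only [Finset.mem_filter, Finset.mem_univ, true_and] at hσ
    exact (mem_cycleMatchings_iff hm _).2 (hmatch σ hσ.2)
  · intro σ hσ τ hτ hM
    simp only [Finset.mem_filter, Finset.mem_univ, true_and] at hσ hτ
    ext1 i
    rw [perm_eq_matchingSwap σ hσ.1 hσ.2, perm_eq_matchingSwap τ hτ.1 hτ.2, hM]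
  · intro M hM
    rw [mem_cycleMatchings_iff hm] at hM
    obtain ⟨σ, hσ, -⟩ := exists_perm_eq_matchingSwap hm M hM
    have e1 := Fin.add_one_ne_self_of_three_le hm
    have e2 := Fin.add_one_add_one_ne_self_of_three_le hm
    have up : ∀ i, σ i = i + 1 ↔ i ∈ M := by
      intro i
      rw [hσ, matchingSwap]
      split_ifs with h1 h2
      · simp [h1]
      · simp only [h1, iff_false]
        exact fun h => e2 (i - 1) (by simpa using h.symm)
      · simp only [h1, iff_false]
        exact (e1 i).symm
    have down : ∀ i, σ (i + 1) = i ↔ i ∈ M := by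
      intro i
      rw [hσ, matchingSwap]
      split_ifs with h1 h2
      · simp only [e2, false_iff]
        exact fun h => hM i h h1
      · simpa using h2
      · rw [add_sub_cancel_right] at h2
        simp [e1, h2]
    refine ⟨σ, ?_, ?_⟩
    · simp only [Finset.mem_filter, Finset.mem_univ, true_and]
      refine ⟨fun i => ?_, fun i => (up i).trans (down i).symm⟩
      rw [hσ, matchingSwap]
      split_ifs <;> simp
    · ext i
      simp [up]
  · intro σ hσ
    simp only [Finset.mem_filter, Finset.mem_univ, true_and] at hσ
    have hM := hmatch σ hσ.2
    have hs := perm_eq_matchingSwap σ hσ.1 hσ.2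
    obtain ⟨τ, hτ, hsign⟩ := exists_perm_eq_matchingSwap hm _ hM
    obtain rfl : σ = τ := Equiv.ext fun i => (hs i).trans (hτ i).symm
    rw [hsign, Finset.prod_congr rfl (fun i _ => by rw [hs i]), prod_matchingSwap A hA _ hM,
      mul_assoc, Units.smul_def]
    simp

theorem det_eq_matchingSum_add (hm : 3 ≤ m) (A : Matrix (Fin m) (Fin m) ℝ)
    (hA : ∀ i j, A i j = A j i)
    (h0 : ∀ i j : Fin m, i ≠ j → j ≠ i + 1 → i ≠ j + 1 → A i j = 0) :
    A.det = matchingSum A + 2 * (-1) ^ (m - 1) * ∏ i, A i (i + 1) := by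
  have e2 := Fin.add_one_add_one_ne_self_of_three_le hm
  set r := finRotate m with hr
  have hrapply : ∀ i, r i = i + 1 := fun i => by rw [hr, finRotate_apply]
  have hrinv : ∀ i, r⁻¹ (i + 1) = i := fun i => by
    rw [Equiv.Perm.inv_eq_iff_eq, hrapply]
  have hne : r ≠ r⁻¹ := fun h => e2 0 (by
    have := hrinv 0
    rwa [← h, hrapply] at this)
  have hterm : Equiv.Perm.sign r • ∏ i, A (r i) i = (-1) ^ (m - 1) * ∏ i, A i (i + 1) := by
    rw [hr, sign_finRotate, ← hr, Units.smul_def,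
      Finset.prod_congr rfl fun i _ => by rw [hrapply, hA]]
    simp
  have hterm' : Equiv.Perm.sign r⁻¹ • ∏ i, A (r⁻¹ i) i =
      (-1) ^ (m - 1) * ∏ i, A i (i + 1) := by
    rw [Equiv.Perm.sign_inv, hr, sign_finRotate, ← hr, Units.smul_def,
      ← Equiv.prod_comp r, Finset.prod_congr rfl fun i _ => by rw [hrapply, hrinv]]
    simp
  rw [Matrix.det_apply, ← sum_involutive_eq_matchingSum hm A hA]
  set I := Finset.univ.filter fun σ : Equiv.Perm (Fin m) =>
    (∀ i, σ i = i ∨ σ i = i + 1 ∨ i = σ i + 1) ∧ (∀ i, σ i = i + 1 ↔ σ (i + 1) = i) with hI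
  have hrI : r ∉ I := by
    simp only [hI, Finset.mem_filter, Finset.mem_univ, true_and, not_and, hrapply, not_forall]
    exact fun _ => ⟨0, fun h => e2 0 (h.1 trivial)⟩
  have hrI' : r⁻¹ ∉ I := by
    simp only [hI, Finset.mem_filter, Finset.mem_univ, true_and, not_and, hrinv, not_forall]
    refine fun _ => ⟨0 + 1, fun h => ?_⟩
    have := h.2 trivial
    rw [hrinv] at this
    exact e2 0 this.symm
  rw [← Finset.sum_subset (Finset.subset_univ (insert r (insert r⁻¹ I))),
    Finset.sum_insert (by simp [hne, hrI]), Finset.sum_insert hrI', hterm, hterm']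
  · ring
  · intro σ _ hσ
    simp only [Finset.mem_insert, not_or] at hσ
    have hloc : ¬ ∀ i, σ i = i ∨ σ i = i + 1 ∨ i = σ i + 1 := fun h => by
      rcases rotation_or_inv_or_involutive hm σ h with h' | h' | h'
      · exact hσ.1 h'
      · exact hσ.2.1 h'
      · exact hσ.2.2 (by simp only [hI, Finset.mem_filter, Finset.mem_univ, true_and]
                         exact ⟨h, h'⟩)
    push Not at hloc
    obtain ⟨i, h1, h2, h3⟩ := hloc
    have : ∏ i, A (σ i) i = 0 := Finset.prod_eq_zero (Finset.mem_univ i) (h0 _ _ h1 h3 h2)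
    rw [this, smul_zero]

end FinCycle

section Image

theorem posSemidef_phi {V : Type*} [Fintype V] [DecidableEq V] (Δ : Finset (Finset V))
    (γ : Finset V → V → ℝ) : (phi Δ γ).PosSemidef := by
  have : phi Δ γ = ∑ F ∈ Δ, Matrix.vecMulVec (fun i => if i ∈ F then γ F i else 0)
      (star fun i => if i ∈ F then γ F i else 0) := by
    ext i j
    simp only [phi, Matrix.of_apply, Matrix.sum_apply, Matrix.vecMulVec_apply, star_trivial]
    refine Finset.sum_congr rfl fun F _ => ?_
    split_ifs <;> simp_all
  rw [this]
  exact Matrix.posSemidef_sum _ fun F _ => Matrix.posSemidef_vecMulVec_self_star _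

variable {m : ℕ} [NeZero m]

theorem cycleEdge_injective (hm : 3 ≤ m) :
    Function.Injective fun i : Fin m => ({i, i + 1} : Finset (Fin m)) := by
  intro i j h
  have hi : i ∈ ({j, j + 1} : Finset (Fin m)) := by
    rw [← show ({i, i + 1} : Finset (Fin m)) = {j, j + 1} from h]; simp
  have hi' : i + 1 ∈ ({j, j + 1} : Finset (Fin m)) := by
    rw [← show ({i, i + 1} : Finset (Fin m)) = {j, j + 1} from h]; simp
  simp only [Finset.mem_insert, Finset.mem_singleton] at hi hi'
  rcases hi with hi | hi
  · exact hi
  rcases hi' with hi' | hi'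
  · exact absurd (by rw [← hi, hi']) (Fin.add_one_add_one_ne_self_of_three_le hm j)
  · exact add_right_cancel hi'

theorem cycleEdge_ne_singleton (hm : 3 ≤ m) (i j : Fin m) :
    ({i, i + 1} : Finset (Fin m)) ≠ {j} := by
  intro h
  have h2 := congrArg Finset.card h
  rw [Finset.card_pair (Fin.add_one_ne_self_of_three_le hm i).symm, Finset.card_singleton] at h2
  omega

theorem sum_cycleComplex (hm : 3 ≤ m) (g : Finset (Fin m) → ℝ) :
    ∑ F ∈ cycleComplex m, g F = g ∅ + ∑ i : Fin m, g {i} + ∑ i : Fin m, g {i, i + 1} := by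
  rw [cycleComplex, Finset.sum_union, Finset.sum_union, Finset.sum_singleton,
    Finset.sum_image (fun _ _ _ _ h => Finset.singleton_injective h),
    Finset.sum_image (fun _ _ _ _ h => cycleEdge_injective hm h)]
  · simp
  · rw [Finset.disjoint_right]
    intro F hF
    obtain ⟨i, -, rfl⟩ := Finset.mem_image.1 hF
    simp only [Finset.mem_union, Finset.mem_singleton, Finset.mem_image, Finset.mem_univ, true_and,
      not_or, not_exists]
    exact ⟨by simp, fun j h => cycleEdge_ne_singleton hm i j h.symm⟩

theorem phi_cycleComplex_self (hm : 3 ≤ m) (γ : Finset (Fin m) → Fin m → ℝ) (i : Fin m) :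
    phi (cycleComplex m) γ (i + 1) (i + 1) = γ {i + 1} (i + 1) ^ 2 +
      (γ {i + 1, i + 1 + 1} (i + 1) ^ 2 + γ {i, i + 1} (i + 1) ^ 2) := by
  have e1 := Fin.add_one_ne_self_of_three_le hm
  simp only [phi, Matrix.of_apply, and_self, ← sq]
  rw [sum_cycleComplex hm]
  simp only [Finset.notMem_empty, if_false, zero_add, Finset.mem_singleton]
  rw [Finset.sum_ite_eq, if_pos (Finset.mem_univ _),
    ← Finset.sum_subset (Finset.subset_univ {i + 1, i}), Finset.sum_pair (e1 i)]
  · simp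
  · intro k _ hk
    simp only [Finset.mem_insert, Finset.mem_singleton, not_or] at hk
    rw [if_neg]
    simp only [Finset.mem_insert, Finset.mem_singleton, not_or]
    exact ⟨fun h => hk.1 h.symm, fun h => hk.2 (add_right_cancel h).symm⟩

theorem phi_cycleComplex_succ (hm : 3 ≤ m) (γ : Finset (Fin m) → Fin m → ℝ) (i : Fin m) :
    phi (cycleComplex m) γ i (i + 1) = γ {i, i + 1} i * γ {i, i + 1} (i + 1) := by
  have e1 := Fin.add_one_ne_self_of_three_le hm
  have e2 := Fin.add_one_add_one_ne_self_of_three_le hm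
  simp only [phi, Matrix.of_apply]
  rw [sum_cycleComplex hm, Finset.sum_eq_zero (s := Finset.univ) (f := fun k => ite _ _ _),
    Finset.sum_eq_single i]
  · simp
  · intro k _ hk
    rw [if_neg]
    simp only [Finset.mem_insert, Finset.mem_singleton, not_and_or, not_or]
    by_cases h : i = k + 1
    · subst h
      exact Or.inr ⟨e2 k, e1 _⟩
    · exact Or.inl ⟨fun h' => hk h'.symm, h⟩
  · simp
  · intro k _
    rw [if_neg]
    simp only [Finset.mem_singleton]
    rintro ⟨rfl, h⟩
    exact e1 _ h

theorem phi_cycleComplex_of_not_adj (hm : 3 ≤ m) (γ : Finset (Fin m) → Fin m → ℝ) (i j : Fin m)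
    (h : i ≠ j) (h1 : j ≠ i + 1) (h2 : i ≠ j + 1) : phi (cycleComplex m) γ i j = 0 := by
  simp only [phi, Matrix.of_apply]
  rw [sum_cycleComplex hm, Finset.sum_eq_zero, Finset.sum_eq_zero]
  · simp
  all_goals
    intro k _
    rw [if_neg]
    simp only [Finset.mem_insert, Finset.mem_singleton]
    grind

/-- A symmetric matrix supported on the cycle lies in the image of the parametrization iff its
edges carry weights `x i`, `y i` whose products are the off-diagonal entries and whose squares
are dominated by the diagonal. -/
theorem mem_phiImage_cycleComplex_iff (hm : 3 ≤ m) (A : Matrix (Fin m) (Fin m) ℝ)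
    (hA : ∀ i j, A i j = A j i)
    (h0 : ∀ i j : Fin m, i ≠ j → j ≠ i + 1 → i ≠ j + 1 → A i j = 0) :
    A ∈ phiImage (cycleComplex m) ↔ ∃ x y : Fin m → ℝ, ∀ i, x i * y i = A i (i + 1) ∧
      x (i + 1) ^ 2 + y i ^ 2 ≤ A (i + 1) (i + 1) := by
  have e1 := Fin.add_one_ne_self_of_three_le hm
  constructor
  · rintro ⟨γ, rfl⟩
    refine ⟨fun i => γ {i, i + 1} i, fun i => γ {i, i + 1} (i + 1), fun i => ⟨?_, ?_⟩⟩
    · rw [phi_cycleComplex_succ hm]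
    · rw [phi_cycleComplex_self hm]
      exact le_add_of_nonneg_left (sq_nonneg _)
  · rintro ⟨x, y, hxy⟩
    let γ : Finset (Fin m) → Fin m → ℝ := fun F k =>
      if F = {k} then √(A k k - x k ^ 2 - y (k - 1) ^ 2)
      else if F = {k, k + 1} then x k else y (k - 1)
    have hs : ∀ i, γ {i + 1} (i + 1) ^ 2 =
        A (i + 1) (i + 1) - x (i + 1) ^ 2 - y i ^ 2 := by
      intro i
      simp only [γ, if_true, add_sub_cancel_right]
      exact Real.sq_sqrt (by linarith [(hxy i).2])
    have hx : ∀ i, γ {i, i + 1} i = x i := fun i => by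
      simp [γ, cycleEdge_ne_singleton hm]
    have hy : ∀ i, γ {i, i + 1} (i + 1) = y i := fun i => by
      have : ({i, i + 1} : Finset (Fin m)) ≠ {i + 1, i + 1 + 1} := fun h =>
        e1 i (cycleEdge_injective hm h).symm
      simp only [γ, cycleEdge_ne_singleton hm, this, if_false, add_sub_cancel_right]
    refine ⟨γ, ?_⟩
    have hsymm : ∀ i j, phi (cycleComplex m) γ i j = phi (cycleComplex m) γ j i := fun i j =>
      by simpa using (posSemidef_phi (cycleComplex m) γ).1.apply j i
    ext i j
    by_cases hij : i = j
    · subst hij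
      obtain ⟨k, rfl⟩ : ∃ k, i = k + 1 := ⟨i - 1, by simp⟩
      rw [phi_cycleComplex_self hm, hs, hx, hy]
      ring
    by_cases h1 : j = i + 1
    · subst h1
      rw [phi_cycleComplex_succ hm, hx, hy, (hxy i).1]
    by_cases h2 : i = j + 1
    · subst h2
      rw [hsymm, hA, phi_cycleComplex_succ hm, hx, hy, (hxy j).1]
    rw [phi_cycleComplex_of_not_adj hm γ i j hij h1 h2, h0 i j hij h1 h2]

end Image

section PosSemidef

variable {n : Type*} [Fintype n] [DecidableEq n] {A : Matrix n n ℝ}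

theorem Matrix.IsHermitian.det_add_smul_one (hA : A.IsHermitian) (t : ℝ) :
    (A + t • (1 : Matrix n n ℝ)).det = ∏ i, (hA.eigenvalues i + t) := by
  have h := congrArg (Polynomial.eval (-t)) hA.charpoly_eq
  rw [Matrix.eval_charpoly, Polynomial.eval_prod] at h
  have h1 : Matrix.scalar n (-t) - A = -(A + t • (1 : Matrix n n ℝ)) := by
    rw [Matrix.scalar_apply, ← Matrix.smul_one_eq_diagonal, neg_smul]
    abel
  have h2 : ∀ i, Polynomial.eval (-t) (Polynomial.X - Polynomial.C ((hA.eigenvalues i : ℝ))) =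
      (-1) * (hA.eigenvalues i + t) := fun i => by simp; ring
  rw [h1, Matrix.det_neg] at h
  simp only [RCLike.ofReal_real_eq_id, id_eq, h2, Finset.prod_mul_distrib, Finset.prod_const,
    Finset.card_univ] at h
  exact mul_left_cancel₀ (pow_ne_zero _ (by norm_num)) h

theorem Matrix.PosSemidef.det_lt_det_add_smul_one [Nonempty n] (hA : A.PosSemidef) {t : ℝ}
    (ht : 0 < t) : A.det < (A + t • (1 : Matrix n n ℝ)).det := by
  have h0 : ∀ i, 0 ≤ hA.1.eigenvalues i := hA.eigenvalues_nonneg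
  rw [hA.1.det_add_smul_one, hA.1.det_eq_prod_eigenvalues]
  simp only [RCLike.ofReal_real_eq_id, id_eq]
  by_cases h : ∃ i, hA.1.eigenvalues i = 0
  · obtain ⟨i, hi⟩ := h
    rw [Finset.prod_eq_zero (Finset.mem_univ i) hi]
    exact Finset.prod_pos fun j _ => by linarith [h0 j]
  · push Not at h
    exact Finset.prod_lt_prod_of_nonempty (fun i _ => lt_of_le_of_ne (h0 i) (h i).symm)
      (fun i _ => by linarith) Finset.univ_nonempty

theorem Matrix.IsHermitian.posSemidef_of_det_add_smul_one_pos (hA : A.IsHermitian)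
    (h : ∀ t : ℝ, 0 < t → 0 < (A + t • (1 : Matrix n n ℝ)).det) : A.PosSemidef := by
  rw [hA.posSemidef_iff_eigenvalues_nonneg]
  intro i
  by_contra hi
  simp only [Pi.zero_apply, not_le] at hi
  have := h (-hA.eigenvalues i) (by linarith)
  rw [hA.det_add_smul_one, Finset.prod_eq_zero (Finset.mem_univ i) (by ring)] at this
  exact lt_irrefl _ this

/-- A positive definite matrix with nonpositive off-diagonal entries maps some positive vector to
a positive vector. -/
theorem Matrix.PosDef.exists_pos_mulVec_pos (hA : A.PosDef) (h : ∀ i j, i ≠ j → A i j ≤ 0) :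
    ∃ w : n → ℝ, (∀ i, 0 < w i) ∧ ∀ i, 0 < (A *ᵥ w) i := by
  set w : n → ℝ := A⁻¹ *ᵥ 1 with hw
  have hAw : A *ᵥ w = 1 := by
    rw [hw, Matrix.mulVec_mulVec, Matrix.mul_nonsing_inv _ hA.det_pos.ne'.isUnit,
      Matrix.one_mulVec]
  set u : n → ℝ := fun i => max (-w i) 0 with hu
  have hu0 : ∀ i, 0 ≤ u i := fun i => le_max_right _ _
  have huw : ∀ i, 0 ≤ u i + w i := fun i => by linarith [le_max_left (-w i) 0]
  have hmul : ∀ i, u i * (u i + w i) = 0 := fun i => by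
    rcases le_total (-w i) 0 with hi | hi
    · simp [hu, max_eq_right hi]
    · simp [hu, max_eq_left hi]
  have hu_eq : u = 0 := by
    by_contra hne
    have h1 := hA.dotProduct_mulVec_pos hne
    have h2 : 0 ≤ u ⬝ᵥ A *ᵥ w := by
      rw [hAw]
      exact Finset.sum_nonneg fun i _ => mul_nonneg (hu0 i) zero_le_one
    have h3 : u ⬝ᵥ A *ᵥ (u + w) ≤ 0 := by
      simp only [dotProduct, Matrix.mulVec, Finset.mul_sum]
      refine Finset.sum_nonpos fun i _ => Finset.sum_nonpos fun j _ => ?_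
      by_cases hij : i = j
      · subst hij
        have : u i * (A i i * (u + w) i) = A i i * (u i * (u i + w i)) := by
          rw [Pi.add_apply]; ring
        rw [this, hmul, mul_zero]
      · exact mul_nonpos_of_nonneg_of_nonpos (hu0 i)
          (mul_nonpos_of_nonpos_of_nonneg (h i j hij) (huw j))
    rw [Matrix.mulVec_add, dotProduct_add] at h3
    rw [star_trivial] at h1
    linarith
  have hw0 : ∀ i, 0 ≤ w i := fun i => by simpa [hu_eq] using huw i
  have hpos : ∀ i, 0 < (A *ᵥ w) i := fun i => by simp [hAw]
  refine ⟨w, fun i => lt_of_le_of_ne (hw0 i) fun hi => ?_, hpos⟩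
  refine (hpos i).not_ge (Finset.sum_nonpos fun j _ => ?_)
  by_cases hij : i = j
  · simp [← hij, ← hi]
  · exact mul_nonpos_of_nonpos_of_nonneg (h i j hij) (hw0 j)

end PosSemidef

section Comparison

variable {n : Type*} [DecidableEq n]

/-- The comparison matrix: same diagonal, off-diagonal entries replaced by `-|A i j|`. -/
def comparisonMatrix (A : Matrix n n ℝ) : Matrix n n ℝ :=
  Matrix.of fun i j => if i = j then A i j else -|A i j|

theorem comparisonMatrix_self (A : Matrix n n ℝ) (i : n) :
    comparisonMatrix A i i = A i i := by simp [comparisonMatrix]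

theorem comparisonMatrix_of_ne (A : Matrix n n ℝ) {i j : n} (h : i ≠ j) :
    comparisonMatrix A i j = -|A i j| := by simp [comparisonMatrix, h]

theorem comparisonMatrix_add_smul_one (A : Matrix n n ℝ) (t : ℝ) :
    comparisonMatrix (A + t • 1) = comparisonMatrix A + t • 1 := by
  ext i j
  by_cases h : i = j
  · subst h; simp [comparisonMatrix]
  · simp [comparisonMatrix, h]

theorem comparisonMatrix_symm {A : Matrix n n ℝ} (hA : ∀ i j, A i j = A j i)
    (i j : n) : comparisonMatrix A i j = comparisonMatrix A j i := by
  simp only [comparisonMatrix, Matrix.of_apply, hA i j, eq_comm (a := i)]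

end Comparison

section Cycle

variable {m : ℕ} [NeZero m]

theorem mulVec_cycle_apply (hm : 3 ≤ m) (A : Matrix (Fin m) (Fin m) ℝ)
    (h0 : ∀ i j : Fin m, i ≠ j → j ≠ i + 1 → i ≠ j + 1 → A i j = 0) (w : Fin m → ℝ) (i : Fin m) :
    (A *ᵥ w) (i + 1) = A (i + 1) i * w i + A (i + 1) (i + 1) * w (i + 1) +
      A (i + 1) (i + 1 + 1) * w (i + 1 + 1) := by
  have e1 := Fin.add_one_ne_self_of_three_le hm
  have e2 := Fin.add_one_add_one_ne_self_of_three_le hm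
  change ∑ j, A (i + 1) j * w j = _
  rw [← Finset.sum_subset (Finset.subset_univ {i, i + 1, i + 1 + 1}),
    Finset.sum_insert, Finset.sum_pair (e1 _).symm]
  · exact (add_assoc _ _ _).symm
  · simp only [Finset.mem_insert, Finset.mem_singleton, not_or]
    exact ⟨(e1 i).symm, (e2 i).symm⟩
  · intro k _ hk
    simp only [Finset.mem_insert, Finset.mem_singleton, not_or] at hk
    rw [h0 _ _ (fun h => hk.2.1 h.symm) hk.2.2 fun h => hk.1 (add_right_cancel h).symm, zero_mul]

theorem exists_weights_of_posDef (hm : 3 ≤ m) (A : Matrix (Fin m) (Fin m) ℝ)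
    (h0 : ∀ i j : Fin m, i ≠ j → j ≠ i + 1 → i ≠ j + 1 → A i j = 0)
    (hle : ∀ i j, i ≠ j → A i j ≤ 0) (hA : A.PosDef) :
    ∃ x y : Fin m → ℝ, ∀ i, x i * y i = A i (i + 1) ∧
      x (i + 1) ^ 2 + y i ^ 2 ≤ A (i + 1) (i + 1) := by
  obtain ⟨w, hw, hAw⟩ := hA.exists_pos_mulVec_pos hle
  have hb : ∀ i, 0 ≤ -A i (i + 1) := fun i =>
    neg_nonneg.2 (hle _ _ (Fin.add_one_ne_self_of_three_le hm i).symm)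
  refine ⟨fun i => √(-A i (i + 1) * w (i + 1) / w i),
    fun i => -√(-A i (i + 1) * w i / w (i + 1)), fun i => ⟨?_, ?_⟩⟩
  · have hi := hw i
    have hi' := hw (i + 1)
    rw [mul_neg, ← Real.sqrt_mul (div_nonneg (mul_nonneg (hb i) hi'.le) hi.le),
      show -A i (i + 1) * w (i + 1) / w i * (-A i (i + 1) * w i / w (i + 1)) =
        (-A i (i + 1)) ^ 2 by field_simp, Real.sqrt_sq (hb i), neg_neg]
  · have hi := hw (i + 1)
    have key := hAw (i + 1)
    have hsymm : A (i + 1) i = A i (i + 1) := by simpa using hA.1.apply i (i + 1)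
    rw [mulVec_cycle_apply hm A h0, hsymm] at key
    rw [neg_sq, Real.sq_sqrt (div_nonneg (mul_nonneg (hb _) (hw _).le) hi.le),
      Real.sq_sqrt (div_nonneg (mul_nonneg (hb i) (hw i).le) hi.le), ← add_div, div_le_iff₀ hi]
    linarith

/-- Weights on the cycle exist as soon as they exist after every small increase of the diagonal. -/
theorem exists_weights_of_forall_pos (a b : Fin m → ℝ)
    (h : ∀ ε : ℝ, 0 < ε → ∃ x y : Fin m → ℝ, ∀ i, x i * y i = b i ∧
      x (i + 1) ^ 2 + y i ^ 2 ≤ a i + ε) :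
    ∃ x y : Fin m → ℝ, ∀ i, x i * y i = b i ∧ x (i + 1) ^ 2 + y i ^ 2 ≤ a i := by
  let K : ℕ → Set ((Fin m → ℝ) × (Fin m → ℝ)) := fun k =>
    ⋂ i, {p | p.1 i * p.2 i = b i} ∩ {p | p.1 (i + 1) ^ 2 + p.2 i ^ 2 ≤ a i + 1 / ((k : ℝ) + 1)}
  have hK : ∀ k p, p ∈ K k ↔ ∀ i, p.1 i * p.2 i = b i ∧
      p.1 (i + 1) ^ 2 + p.2 i ^ 2 ≤ a i + 1 / ((k : ℝ) + 1) := fun k p => by simp [K]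
  have hclosed : ∀ k, IsClosed (K k) := fun k => isClosed_iInter fun i =>
    (isClosed_eq (by fun_prop) (by fun_prop)).inter (isClosed_le (by fun_prop) (by fun_prop))
  have hcompact : IsCompact (K 0) := by
    have hbox : IsCompact
        ((Set.univ.pi fun i : Fin m => Set.Icc (-(a (i - 1) + 2)) (a (i - 1) + 2)) ×ˢ
          (Set.univ.pi fun i : Fin m => Set.Icc (-(a i + 2)) (a i + 2))) :=
      (isCompact_univ_pi fun _ => isCompact_Icc).prod (isCompact_univ_pi fun _ => isCompact_Icc)
    refine hbox.of_isClosed_subset (hclosed 0) fun p hp => ?_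
    rw [hK] at hp
    simp only [Nat.cast_zero, zero_add, div_one] at hp
    refine ⟨fun i _ => ?_, fun i _ => ?_⟩
    · have := (hp (i - 1)).2
      rw [sub_add_cancel] at this
      constructor <;> nlinarith [sq_nonneg (p.1 i - 1), sq_nonneg (p.1 i + 1),
        sq_nonneg (p.2 (i - 1))]
    · have := (hp i).2
      constructor <;> nlinarith [sq_nonneg (p.2 i - 1), sq_nonneg (p.2 i + 1),
        sq_nonneg (p.1 (i + 1))]
  obtain ⟨p, hp⟩ := IsCompact.nonempty_iInter_of_sequence_nonempty_isCompact_isClosed K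
    (fun k p hp => by
      rw [hK] at hp ⊢
      intro i
      refine ⟨(hp i).1, (hp i).2.trans (add_le_add le_rfl ?_)⟩
      exact Nat.one_div_le_one_div (Nat.le_succ k))
    (fun k => by
      obtain ⟨x, y, hxy⟩ := h (1 / ((k : ℝ) + 1)) Nat.one_div_pos_of_nat
      exact ⟨(x, y), (hK k _).2 hxy⟩) hcompact hclosed
  rw [Set.mem_iInter] at hp
  refine ⟨p.1, p.2, fun i => ⟨((hK 0 p).1 (hp 0) i).1, ?_⟩⟩
  refine le_of_forall_pos_le_add fun ε hε => ?_
  obtain ⟨k, hk⟩ := exists_nat_one_div_lt hε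
  exact ((hK k p).1 (hp k) i).2.trans (by linarith)

theorem exists_weights_of_posSemidef (hm : 3 ≤ m) (A : Matrix (Fin m) (Fin m) ℝ)
    (h0 : ∀ i j : Fin m, i ≠ j → j ≠ i + 1 → i ≠ j + 1 → A i j = 0)
    (hle : ∀ i j, i ≠ j → A i j ≤ 0) (hA : A.PosSemidef) :
    ∃ x y : Fin m → ℝ, ∀ i, x i * y i = A i (i + 1) ∧
      x (i + 1) ^ 2 + y i ^ 2 ≤ A (i + 1) (i + 1) := by
  refine exists_weights_of_forall_pos (fun i => A (i + 1) (i + 1)) _ fun ε hε => ?_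
  have hoff : ∀ i j, i ≠ j → (ε • (1 : Matrix (Fin m) (Fin m) ℝ) + A) i j = A i j :=
    fun i j hij => by simp [hij]
  obtain ⟨x, y, hxy⟩ := exists_weights_of_posDef hm (ε • (1 : Matrix (Fin m) (Fin m) ℝ) + A)
    (fun i j hij h1 h2 => by rw [hoff i j hij, h0 i j hij h1 h2])
    (fun i j hij => by rw [hoff i j hij]; exact hle i j hij)
    ((Matrix.PosDef.one.smul hε).add_posSemidef hA)
  refine ⟨x, y, fun i => ⟨?_, ?_⟩⟩
  · rw [(hxy i).1, hoff _ _ (Fin.add_one_ne_self_of_three_le hm i).symm]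
  · refine (hxy i).2.trans_eq ?_
    simp [add_comm]

theorem matchingSum_comparisonMatrix (hm : 3 ≤ m) (A : Matrix (Fin m) (Fin m) ℝ) :
    matchingSum (comparisonMatrix A) = matchingSum A := by
  have h : ∀ i, comparisonMatrix A i (i + 1) ^ 2 = A i (i + 1) ^ 2 := fun i => by
    rw [comparisonMatrix_of_ne A (Fin.add_one_ne_self_of_three_le hm i).symm, neg_sq, sq_abs]
  simp only [matchingSum, h, comparisonMatrix_self]

theorem comparisonMatrix_of_not_adj {A : Matrix (Fin m) (Fin m) ℝ}
    (h0 : ∀ i j : Fin m, i ≠ j → j ≠ i + 1 → i ≠ j + 1 → A i j = 0)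
    (i j : Fin m) (h : i ≠ j) (h1 : j ≠ i + 1) (h2 : i ≠ j + 1) :
    comparisonMatrix A i j = 0 := by
  rw [comparisonMatrix_of_ne A h, h0 i j h h1 h2, abs_zero, neg_zero]

theorem det_comparisonMatrix (hm : 3 ≤ m) (A : Matrix (Fin m) (Fin m) ℝ)
    (hA : ∀ i j, A i j = A j i)
    (h0 : ∀ i j : Fin m, i ≠ j → j ≠ i + 1 → i ≠ j + 1 → A i j = 0) :
    (comparisonMatrix A).det = matchingSum A - 2 * ∏ i, |A i (i + 1)| := by
  rw [det_eq_matchingSum_add hm _ (comparisonMatrix_symm hA) (comparisonMatrix_of_not_adj h0),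
    matchingSum_comparisonMatrix hm,
    Finset.prod_congr rfl fun i _ => comparisonMatrix_of_ne A
      (Fin.add_one_ne_self_of_three_le hm i).symm, Finset.prod_neg, Finset.card_univ,
    Fintype.card_fin]
  obtain ⟨k, rfl⟩ : ∃ k, m = k + 1 := ⟨m - 1, by omega⟩
  have : (-1 : ℝ) ^ k * (-1) ^ k = 1 := by rw [← mul_pow]; simp
  rw [Nat.add_sub_cancel, pow_succ]
  linear_combination (-2 * ∏ i : Fin (k + 1), |A i (i + 1)|) * this

theorem posSemidef_comparisonMatrix (hm : 3 ≤ m) (A : Matrix (Fin m) (Fin m) ℝ)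
    (hA : A.PosSemidef)
    (h0 : ∀ i j : Fin m, i ≠ j → j ≠ i + 1 → i ≠ j + 1 → A i j = 0)
    (hdet : 0 ≤ (comparisonMatrix A).det) : (comparisonMatrix A).PosSemidef := by
  have hsymm : ∀ i j, A i j = A j i := fun i j => by simpa using hA.1.apply j i
  have hherm : (comparisonMatrix A).IsHermitian := Matrix.IsHermitian.ext fun i j => by
    rw [star_trivial, comparisonMatrix_symm hsymm]
  refine hherm.posSemidef_of_det_add_smul_one_pos fun t ht => ?_
  have hoff : ∀ i j, i ≠ j → (A + t • (1 : Matrix (Fin m) (Fin m) ℝ)) i j = A i j :=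
    fun i j hij => by simp [hij]
  have hsymm' : ∀ i j, (A + t • (1 : Matrix (Fin m) (Fin m) ℝ)) i j =
      (A + t • (1 : Matrix (Fin m) (Fin m) ℝ)) j i := fun i j => by
    by_cases hij : i = j
    · rw [hij]
    · rw [hoff i j hij, hoff j i (Ne.symm hij), hsymm]
  have h0' : ∀ i j : Fin m, i ≠ j → j ≠ i + 1 → i ≠ j + 1 →
      (A + t • (1 : Matrix (Fin m) (Fin m) ℝ)) i j = 0 := fun i j hij h1 h2 => by
    rw [hoff i j hij, h0 i j hij h1 h2]
  have hb : ∀ i, (A + t • (1 : Matrix (Fin m) (Fin m) ℝ)) i (i + 1) = A i (i + 1) := fun i =>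
    hoff _ _ (Fin.add_one_ne_self_of_three_le hm i).symm
  have d1 := det_eq_matchingSum_add hm A hsymm h0
  have d2 := det_eq_matchingSum_add hm _ hsymm' h0'
  have d3 := det_comparisonMatrix hm A hsymm h0
  have d4 := det_comparisonMatrix hm _ hsymm' h0'
  simp only [hb] at d2 d4
  rw [comparisonMatrix_add_smul_one] at d4
  have := hA.det_lt_det_add_smul_one ht
  linarith

end Cycle

/-- a matrix `Σ ∈ S⪰0^m(C_m)` lies in the image of `φ_{C_m}` if
and only if
`∑_{M ∈ M(C_m)} (−1)^{|M|} ∏_{{i,j} ∈ M} σ_ij² ∏_{i ∈ [m]∖M} σ_ii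
  ≥ 2 ∏_{i=1}^m |σ_{i,i+1}|`. -/
theorem mem_image_cycle_iff_matchingSum_ge (m : ℕ) [NeZero m] (hm : 3 ≤ m)
    (S : Matrix (Fin m) (Fin m) ℝ) (hS : S ∈ cyclePSDCone m) :
    S ∈ phiImage (cycleComplex m) ↔
      2 * ∏ i : Fin m, |S i (i + 1)| ≤ matchingSum S := by
  obtain ⟨hpsd, h0⟩ := hS
  have hsymm : ∀ i j, S i j = S j i := fun i j => by simpa using hpsd.1.apply j i
  have e1 := Fin.add_one_ne_self_of_three_le hm
  have hoff : ∀ i, comparisonMatrix S i (i + 1) = -|S i (i + 1)| := fun i =>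
    comparisonMatrix_of_ne S (e1 i).symm
  have hdet := det_comparisonMatrix hm S hsymm h0
  constructor
  · intro h
    obtain ⟨x, y, hxy⟩ := (mem_phiImage_cycleComplex_iff hm S hsymm h0).1 h
    have hmem : comparisonMatrix S ∈ phiImage (cycleComplex m) := by
      refine (mem_phiImage_cycleComplex_iff hm _ (comparisonMatrix_symm hsymm)
        (comparisonMatrix_of_not_adj h0)).2 ⟨fun i => |x i|, fun i => -|y i|, fun i => ⟨?_, ?_⟩⟩
      · rw [hoff, ← (hxy i).1, abs_mul, mul_neg]
      · rw [comparisonMatrix_self, neg_sq, sq_abs, sq_abs]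
        exact (hxy i).2
    obtain ⟨γ, hγ⟩ := hmem
    have := (posSemidef_phi (cycleComplex m) γ).det_nonneg
    rw [hγ] at this
    linarith
  · intro h
    obtain ⟨x, y, hxy⟩ := exists_weights_of_posSemidef hm (comparisonMatrix S)
      (comparisonMatrix_of_not_adj h0)
      (fun i j hij => by rw [comparisonMatrix_of_ne S hij]; exact neg_nonpos.2 (abs_nonneg _))
      (posSemidef_comparisonMatrix hm S hpsd h0 (by linarith))
    refine (mem_phiImage_cycleComplex_iff hm S hsymm h0).2
      ⟨x, fun i => if 0 ≤ S i (i + 1) then -y i else y i, fun i => ?_⟩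
    have h1 := (hxy i).1
    have h2 := (hxy i).2
    rw [hoff] at h1
    rw [comparisonMatrix_self] at h2
    dsimp only
    split_ifs with hi
    · rw [abs_of_nonneg hi] at h1
      exact ⟨by linarith, by rwa [neg_sq]⟩
    · rw [abs_of_neg (not_le.1 hi)] at h1
      exact ⟨by linarith, h2⟩
end

section
/- Let m ≥ 3 and let Σ = (σ_ij) ∈ S⪰0^m(C_m) be positive definite and satisfy Σ_{M ∈ M(C_m)} (−1)^{|M|} ∏_{{i,j}∈M} σ_ij² ∏_{i ∈ [m]∖M} σ_ii ≥ 2 ∏_{i=1}^m |σ_{i,i+1}|. Then every complex solution (γ_{i,i−1}, γ_{i,i+1})_{i=1,…,m} ∈ ℂ^{2m} of the system γ_{i,i−1}² + γ_{i,i+1}² = σ_ii (i = 1,…,m) and γ_{i−1,i} γ_{i,i−1} = σ_{i−1,i} (i = 1,…,m), with indices read modulo m, is real. -/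
open Matrix

open Finset

/-- The quadratic form of a weighted cycle on the vertices `0, …, N`, with the edge `{N, 0}`
split off. -/
def cyclicForm (N : ℕ) (a s w : ℕ → ℝ) : ℝ :=
  ∑ i ∈ range (N + 1), a i * w i ^ 2 + 2 * ∑ i ∈ range N, s i * w i * w (i + 1) +
    2 * (s N * w N * w 0)

/-- If `w` solves the two-sided recurrence along the path `0, …, k`, the quadratic form of the
path reduces to boundary terms. -/
lemma path_form_eq_boundary (k : ℕ) (a s w p r : ℕ → ℝ)
    (ha : ∀ i ≤ k, a i * w i = p i + r i)
    (hp : ∀ i < k, p i = -(s i * w (i + 1)))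
    (hr : ∀ i < k, r (i + 1) = -(s i * w i)) :
    ∑ i ∈ range (k + 1), a i * w i ^ 2 + 2 * ∑ i ∈ range k, s i * w i * w (i + 1) =
      p k * w k + r 0 * w 0 := by
  have h1 : ∑ i ∈ range (k + 1), a i * w i ^ 2 =
      ∑ i ∈ range (k + 1), p i * w i + ∑ i ∈ range (k + 1), r i * w i := by
    rw [← sum_add_distrib]
    refine sum_congr rfl fun i hi => ?_
    linear_combination w i * ha i (by simpa [Nat.lt_succ_iff] using hi)
  have h2 : ∑ i ∈ range k, p i * w i = -∑ i ∈ range k, s i * w i * w (i + 1) := by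
    rw [← sum_neg_distrib]
    refine sum_congr rfl fun i hi => ?_
    linear_combination w i * hp i (by simpa using hi)
  have h3 : ∑ i ∈ range k, r (i + 1) * w (i + 1) = -∑ i ∈ range k, s i * w i * w (i + 1) := by
    rw [← sum_neg_distrib]
    refine sum_congr rfl fun i hi => ?_
    linear_combination w (i + 1) * hr i (by simpa using hi)
  rw [h1, sum_range_succ, sum_range_succ' (fun i => r i * w i), h2, h3]
  ring

/-- On a cycle with nonvanishing edge weights, a complex solution with real product `∏ x i` has
`x N` real and nonnegative. -/
lemma last_nonneg_of_prod_real (N : ℕ) (a s : ℕ → ℝ) (x y : ℕ → ℂ)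
    (hpos : ∀ w : ℕ → ℝ, (∃ i ≤ N, w i ≠ 0) → 0 < cyclicForm N a s w)
    (hsum : ∀ i ≤ N, x i + y i = a i)
    (hmul : ∀ i < N, x i * y (i + 1) = (s i : ℂ) ^ 2)
    (hlast : x N * y 0 = (s N : ℂ) ^ 2)
    (hs : ∀ i ≤ N, s i ≠ 0)
    (hprod : (∏ i ∈ range (N + 1), x i).im = 0) :
    (x N).im = 0 ∧ 0 ≤ (x N).re := by
  set v : ℕ → ℂ := fun n => ∏ l ∈ range n, (-x l / s l) with hv
  have hsC : ∀ i ≤ N, (s i : ℂ) ≠ 0 := fun i hi => by exact_mod_cast hs i hi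
  have hv0 : v 0 = 1 := by simp [hv]
  have hvx : ∀ i < N, x i * v i = -(s i * v (i + 1)) := by
    intro i hi
    have := hsC i hi.le
    simp only [hv, prod_range_succ]
    field_simp
  have hvy : ∀ i < N, y (i + 1) * v (i + 1) = -(s i * v i) := by
    intro i hi
    apply mul_left_cancel₀ (hsC i hi.le)
    linear_combination y (i + 1) * hvx i hi - v i * hmul i hi
  have hvN : (x N * v N).im = 0 := by
    have h : x N * v N =
        (∏ i ∈ range (N + 1), x i) * ((∏ i ∈ range N, (-1 / s i) : ℝ) : ℂ) := by
      rw [prod_range_succ, mul_comm _ (x N), mul_assoc, Complex.ofReal_prod, ← prod_mul_distrib]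
      simp only [hv]
      congr 1
      refine prod_congr rfl fun i _ => ?_
      push_cast
      ring
    rw [h, Complex.im_mul_ofReal, hprod, zero_mul]
  have hva : ∀ i ≤ N, (a i : ℂ) * v i = x i * v i + y i * v i := by
    intro i hi
    rw [← hsum i hi]
    ring
  have him : ∀ i ≤ N, (v i).im = 0 := by
    by_contra! hne
    have hQ := hpos (fun i => (v i).im) hne
    have := path_form_eq_boundary N a s (fun i => (v i).im)
      (fun i => (x i * v i).im) (fun i => (y i * v i).im)
      (fun i hi => by simpa using congrArg Complex.im (hva i hi))
      (fun i hi => by simpa using congrArg Complex.im (hvx i hi))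
      (fun i hi => by simpa using congrArg Complex.im (hvy i hi))
    rw [cyclicForm, this] at hQ
    simp [hvN, hv0] at hQ
  have hQ := hpos (fun i => (v i).re) ⟨0, Nat.zero_le _, by simp [hv0]⟩
  have hB := path_form_eq_boundary N a s (fun i => (v i).re)
      (fun i => (x i * v i).re) (fun i => (y i * v i).re)
      (fun i hi => by simpa using congrArg Complex.re (hva i hi))
      (fun i hi => by simpa using congrArg Complex.re (hvx i hi))
      (fun i hi => by simpa using congrArg Complex.re (hvy i hi))
  rw [cyclicForm, hB] at hQ
  have hne : ∀ i ≤ N, x i ≠ 0 := by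
    intro i hi h0
    rcases hi.lt_or_eq with hlt | rfl
    · exact pow_ne_zero 2 (hsC i hi) (by rw [← hmul i hlt, h0, zero_mul])
    · exact pow_ne_zero 2 (hsC i le_rfl) (by rw [← hlast, h0, zero_mul])
  have hvne : v N ≠ 0 := prod_ne_zero_iff.2 fun i hi =>
    div_ne_zero (neg_ne_zero.2 (hne i (mem_range.1 hi).le)) (hsC i (mem_range.1 hi).le)
  have hvre : (v N).re ≠ 0 := fun h => hvne (Complex.ext h (him N le_rfl))
  have hxim : (x N).im = 0 := by
    have h := hvN
    rw [Complex.mul_im, him N le_rfl, mul_zero, zero_add] at h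
    exact (mul_eq_zero.1 h).resolve_right hvre
  refine ⟨hxim, ?_⟩
  have hre := congrArg Complex.re hlast
  rw [← Complex.ofReal_pow, Complex.ofReal_re, Complex.mul_re, hxim, zero_mul, sub_zero] at hre
  simp only [Complex.mul_re, hxim, hv0, Complex.one_re, zero_mul, sub_zero,
    mul_one] at hQ
  by_contra! hneg
  have := mul_neg_of_neg_of_pos hneg hQ
  nlinarith [sq_nonneg ((x N).re * (v N).re + s N)]

/-- If the edge `{N, 0}` has weight zero and `y 0 = 0`, then the solution is determined
recursively and is real and nonnegative. -/
lemma nonneg_of_path (N : ℕ) (a s : ℕ → ℝ) (x y : ℕ → ℂ)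
    (hpos : ∀ w : ℕ → ℝ, (∃ i ≤ N, w i ≠ 0) → 0 < cyclicForm N a s w)
    (hsum : ∀ i ≤ N, x i + y i = a i)
    (hmul : ∀ i < N, x i * y (i + 1) = (s i : ℂ) ^ 2)
    (hs : s N = 0) (hy : y 0 = 0) :
    ∀ k ≤ N, ((x k).im = 0 ∧ 0 < (x k).re) ∧ (y k).im = 0 ∧ 0 ≤ (y k).re := by
  intro k
  induction k using Nat.strong_induction_on with
  | _ k ih =>
  intro hk
  have hyk : (y k).im = 0 ∧ 0 ≤ (y k).re := by
    rcases k with _ | k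
    · simp [hy]
    · obtain ⟨⟨hxi, hxr⟩, -⟩ := ih k (Nat.lt_succ_self k) (by omega)
      have hm := hmul k (by omega)
      rw [← Complex.ofReal_pow] at hm
      have h1 := congrArg Complex.im hm
      have h2 := congrArg Complex.re hm
      rw [Complex.mul_im, hxi, zero_mul, add_zero, Complex.ofReal_im] at h1
      rw [Complex.mul_re, hxi, zero_mul, sub_zero, Complex.ofReal_re] at h2
      refine ⟨(mul_eq_zero.1 h1).resolve_left hxr.ne', ?_⟩
      exact nonneg_of_mul_nonneg_right (h2 ▸ sq_nonneg (s k)) hxr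
  have hxk : (x k).im = 0 := by
    have := congrArg Complex.im (hsum k hk)
    simpa [hyk.1] using this
  refine ⟨⟨hxk, ?_⟩, hyk⟩
  set u : ℕ → ℝ := fun i => ∏ l ∈ Ico i k, (-s l / (x l).re) with hu
  have huk : u k = 1 := by simp [hu]
  have hux : ∀ i < k, (x i).re * u i = -(s i * u (i + 1)) := by
    intro i hi
    have := (ih i hi (by omega)).1.2.ne'
    simp only [hu]
    rw [prod_eq_prod_Ico_succ_bot hi]
    field_simp
  have huy : ∀ i < k, (y (i + 1)).re * u (i + 1) = -(s i * u i) := by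
    intro i hi
    obtain ⟨⟨hxi, hxr⟩, -⟩ := ih i hi (by omega)
    have h2 := congrArg Complex.re (hmul i (by omega))
    rw [← Complex.ofReal_pow, Complex.mul_re, hxi, zero_mul, sub_zero, Complex.ofReal_re] at h2
    apply mul_left_cancel₀ hxr.ne'
    linear_combination u (i + 1) * h2 + s i * hux i hi
  have hB := path_form_eq_boundary k a s u
    (fun i => (x i).re * u i) (fun i => (y i).re * u i)
    (fun i hi => by
      have := congrArg Complex.re (hsum i (by omega))
      rw [Complex.add_re, Complex.ofReal_re] at this
      rw [← this]
      ring) hux huy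
  set w : ℕ → ℝ := fun i => if i ≤ k then u i else 0 with hw
  have hwu : ∀ i ≤ k, w i = u i := fun i hi => if_pos hi
  have hw0 : ∀ i, k < i → w i = 0 := fun i hi => if_neg (by omega)
  have hQ := hpos w ⟨k, hk, by rw [hwu k le_rfl, huk]; exact one_ne_zero⟩
  have e1 : ∑ i ∈ range (N + 1), a i * w i ^ 2 = ∑ i ∈ range (k + 1), a i * u i ^ 2 := by
    rw [← sum_subset (range_mono (by omega : k + 1 ≤ N + 1))]
    · refine sum_congr rfl fun i hi => ?_
      rw [hwu i (by simpa [Nat.lt_succ_iff] using hi)]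
    · intro i _ hi
      rw [hw0 i (by simpa using hi)]
      ring
  have e2 : ∑ i ∈ range N, s i * w i * w (i + 1) = ∑ i ∈ range k, s i * u i * u (i + 1) := by
    rw [← sum_subset (range_mono hk)]
    · refine sum_congr rfl fun i hi => ?_
      have := mem_range.1 hi
      rw [hwu i (by omega), hwu (i + 1) (by omega)]
    · intro i _ hi
      rw [hw0 (i + 1) (by simp at hi; omega)]
      ring
  rw [cyclicForm, e1, e2, hB, hs, hy, huk] at hQ
  simpa using hQ

/-- Positivity of the quadratic form of a weighted cycle on `Fin m`. -/
def CyclePos {m : ℕ} [NeZero m] (a s : Fin m → ℝ) : Prop :=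
  ∀ v : Fin m → ℝ, v ≠ 0 → 0 < ∑ i, a i * v i ^ 2 + 2 * ∑ i, s i * v i * v (i + 1)

/-- The enumeration of the cycle on `Fin (N + 1)` that ends at `j`. -/
def cycleEnum {N : ℕ} (j : Fin (N + 1)) (n : ℕ) : Fin (N + 1) :=
  Fin.ofNat (N + 1) n + (j + 1)

lemma cycleEnum_val {N : ℕ} (j i : Fin (N + 1)) : cycleEnum j i.val = i + (j + 1) := by
  simp [cycleEnum]

lemma cycleEnum_succ {N : ℕ} (j : Fin (N + 1)) (n : ℕ) :
    cycleEnum j (n + 1) = cycleEnum j n + 1 := by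
  have : Fin.ofNat (N + 1) (n + 1) = Fin.ofNat (N + 1) n + 1 := by
    apply Fin.ext
    simp [Fin.val_add, Nat.add_mod]
  rw [cycleEnum, cycleEnum, this]
  abel

lemma cycleEnum_last {N : ℕ} (j : Fin (N + 1)) : cycleEnum j N = j := by
  have h := cycleEnum_val j (Fin.last N)
  rw [Fin.val_last] at h
  rw [h, add_comm j, ← add_assoc, Fin.last_add_one, zero_add]

lemma cycleEnum_zero {N : ℕ} (j : Fin (N + 1)) : cycleEnum j 0 = j + 1 := by
  simp [cycleEnum]

lemma exists_cycleEnum {N : ℕ} (j i : Fin (N + 1)) : ∃ n ≤ N, cycleEnum j n = i :=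
  ⟨(i - (j + 1)).val, Nat.lt_succ_iff.1 (i - (j + 1)).isLt, by
    rw [cycleEnum_val, sub_add_cancel]⟩

lemma prod_cycleEnum {N : ℕ} (j : Fin (N + 1)) (f : Fin (N + 1) → ℂ) :
    ∏ n ∈ range (N + 1), f (cycleEnum j n) = ∏ i, f i := by
  rw [← Fin.prod_univ_eq_prod_range (fun n => f (cycleEnum j n))]
  simp only [cycleEnum_val]
  exact Equiv.prod_comp (Equiv.addRight (j + 1)) f

lemma sum_cycleEnum {N : ℕ} (j : Fin (N + 1)) (f : Fin (N + 1) → ℝ) :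
    ∑ n ∈ range (N + 1), f (cycleEnum j n) = ∑ i, f i := by
  rw [← Fin.sum_univ_eq_sum_range (fun n => f (cycleEnum j n))]
  simp only [cycleEnum_val]
  exact Equiv.sum_comp (Equiv.addRight (j + 1)) f

lemma CyclePos.cyclicForm_pos {N : ℕ} {a s : Fin (N + 1) → ℝ} (h : CyclePos a s)
    (j : Fin (N + 1)) (w : ℕ → ℝ) (hw : ∃ i ≤ N, w i ≠ 0) :
    0 < cyclicForm N (fun n => a (cycleEnum j n)) (fun n => s (cycleEnum j n)) w := by
  set v : Fin (N + 1) → ℝ := fun i => w (i - (j + 1)).val with hv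
  have hvw : ∀ n ≤ N, v (cycleEnum j n) = w n := by
    intro n hn
    simp [hv, cycleEnum, Nat.mod_eq_of_lt (Nat.lt_succ_of_le hn)]
  have hv0 : v ≠ 0 := by
    obtain ⟨i, hi, hne⟩ := hw
    intro h0
    exact hne (by rw [← hvw i hi, h0, Pi.zero_apply])
  have hQ := h v hv0
  rw [← sum_cycleEnum j, ← sum_cycleEnum j, sum_range_succ (fun n => s _ * _ * _)] at hQ
  have e1 : ∑ n ∈ range (N + 1), a (cycleEnum j n) * v (cycleEnum j n) ^ 2 =
      ∑ n ∈ range (N + 1), a (cycleEnum j n) * w n ^ 2 :=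
    sum_congr rfl fun n hn => by rw [hvw n (Nat.lt_succ_iff.1 (mem_range.1 hn))]
  have e2 : ∑ n ∈ range N, s (cycleEnum j n) * v (cycleEnum j n) * v (cycleEnum j n + 1) =
      ∑ n ∈ range N, s (cycleEnum j n) * w n * w (n + 1) :=
    sum_congr rfl fun n hn => by
      have := mem_range.1 hn
      rw [← cycleEnum_succ, hvw n this.le, hvw (n + 1) this]
  have e3 : v (cycleEnum j N + 1) = w 0 := by
    rw [cycleEnum_last, ← cycleEnum_zero, hvw 0 (Nat.zero_le _)]
  rw [e1, e2, e3, hvw N le_rfl] at hQ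
  rw [cyclicForm]
  linarith

lemma CyclePos.nonneg_of_prod_real {N : ℕ} {a s : Fin (N + 1) → ℝ} (h : CyclePos a s)
    {x y : Fin (N + 1) → ℂ} (hsum : ∀ i, x i + y i = a i)
    (hmul : ∀ i, x i * y (i + 1) = (s i : ℂ) ^ 2) (hs : ∀ i, s i ≠ 0)
    (hprod : (∏ i, x i).im = 0) (j : Fin (N + 1)) :
    (x j).im = 0 ∧ 0 ≤ (x j).re := by
  have := last_nonneg_of_prod_real N (fun n => a (cycleEnum j n)) (fun n => s (cycleEnum j n))
    (fun n => x (cycleEnum j n)) (fun n => y (cycleEnum j n)) (h.cyclicForm_pos j)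
    (fun i _ => hsum _) (fun i _ => by rw [cycleEnum_succ]; exact hmul _)
    (by rw [cycleEnum_zero, cycleEnum_last]; exact hmul j) (fun i _ => hs _)
    (by rw [prod_cycleEnum]; exact hprod)
  rwa [cycleEnum_last] at this

lemma CyclePos.nonneg_of_left_eq_zero {N : ℕ} {a s : Fin (N + 1) → ℝ} (h : CyclePos a s)
    {x y : Fin (N + 1) → ℂ} (hsum : ∀ i, x i + y i = a i)
    (hmul : ∀ i, x i * y (i + 1) = (s i : ℂ) ^ 2) {j : Fin (N + 1)} (hs : s j = 0)
    (hy : y (j + 1) = 0) (i : Fin (N + 1)) :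
    ((x i).im = 0 ∧ 0 ≤ (x i).re) ∧ (y i).im = 0 ∧ 0 ≤ (y i).re := by
  obtain ⟨n, hn, rfl⟩ := exists_cycleEnum j i
  have := nonneg_of_path N (fun n => a (cycleEnum j n)) (fun n => s (cycleEnum j n))
    (fun n => x (cycleEnum j n)) (fun n => y (cycleEnum j n)) (h.cyclicForm_pos j)
    (fun i _ => hsum _) (fun i _ => by rw [cycleEnum_succ]; exact hmul _)
    (by rw [cycleEnum_last]; exact hs) (by rw [cycleEnum_zero]; exact hy) n hn
  exact ⟨⟨this.1.1, this.1.2.le⟩, this.2⟩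

/-- Reversing the orientation of the cycle preserves positivity. -/
lemma CyclePos.reflect {N : ℕ} {a s : Fin (N + 1) → ℝ} (h : CyclePos a s) :
    CyclePos (fun i => a (-i)) (fun i => s (-(i + 1))) := by
  intro v hv
  have hQ := h (fun i => v (-i)) (fun h0 => hv (funext fun i => by
    simpa using congrFun h0 (-i)))
  have e1 : ∑ i, a (-i) * v i ^ 2 = ∑ i, a i * v (-i) ^ 2 := by
    rw [← Equiv.sum_comp (Equiv.neg (Fin (N + 1))) (fun i => a i * v (-i) ^ 2)]
    simp
  have e2 : ∑ i, s (-(i + 1)) * v i * v (i + 1) = ∑ i, s i * v (-i) * v (-(i + 1)) := by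
    rw [← Equiv.sum_comp ((Equiv.addRight (1 : Fin (N + 1))).trans (Equiv.neg _))
      (fun i => s i * v (-i) * v (-(i + 1)))]
    refine sum_congr rfl fun i _ => ?_
    have : -(-(i + 1) + 1) = i := by abel
    simp only [Equiv.trans_apply, Equiv.coe_addRight, Equiv.neg_apply, this, neg_neg]
    ring
  rw [e1, e2]
  exact hQ

lemma CyclePos.nonneg_of_edge_eq_zero {N : ℕ} {a s : Fin (N + 1) → ℝ} (h : CyclePos a s)
    {x y : Fin (N + 1) → ℂ} (hsum : ∀ i, x i + y i = a i)
    (hmul : ∀ i, x i * y (i + 1) = (s i : ℂ) ^ 2) {j : Fin (N + 1)} (hs : s j = 0)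
    (i : Fin (N + 1)) :
    ((x i).im = 0 ∧ 0 ≤ (x i).re) ∧ (y i).im = 0 ∧ 0 ≤ (y i).re := by
  have h0 : x j * y (j + 1) = 0 := by rw [hmul j, hs]; simp
  rcases mul_eq_zero.1 h0 with hx | hy
  · have := h.reflect.nonneg_of_left_eq_zero (x := fun i => y (-i)) (y := fun i => x (-i))
      (fun i => by rw [add_comm]; exact hsum (-i))
      (fun i => by
        have := hmul (-(i + 1))
        rwa [show -(i + 1) + 1 = -i by abel, mul_comm] at this)
      (j := -(j + 1)) (by rw [show -(-(j + 1) + 1) = j by abel]; exact hs)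
      (by rw [show -(-(j + 1) + 1) = j by abel]; exact hx) (-i)
    simpa only [neg_neg, and_comm] using this.symm
  · exact h.nonneg_of_left_eq_zero hsum hmul hs hy i

/-- A subset of the cycle closed under successors is empty or everything. -/
lemma eq_empty_or_univ_of_succ_mem {N : ℕ} (A : Finset (Fin (N + 1)))
    (hA : ∀ i ∈ A, i + 1 ∈ A) : A = ∅ ∨ A = univ := by
  rcases A.eq_empty_or_nonempty with h | ⟨j, hj⟩
  · exact Or.inl h
  · refine Or.inr (eq_univ_iff_forall.2 fun i => ?_)
    have hmem : ∀ n, cycleEnum j n ∈ A := by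
      intro n
      induction n with
      | zero => rw [cycleEnum_zero]; exact hA j hj
      | succ n ih => rw [cycleEnum_succ]; exact hA _ ih
    obtain ⟨n, -, rfl⟩ := exists_cycleEnum j i
    exact hmem n

/-- The matching expansion of the cycle with vertex weights `x i + y i` and edge weights
`x i * y (i + 1)` is `∏ x i + ∏ y i`. -/
lemma matching_expansion_eq {N : ℕ} (hN : 1 ≤ N) (x y : Fin (N + 1) → ℂ) :
    ∑ M ∈ cycleMatchings (N + 1), (-1 : ℂ) ^ M.card * (∏ i ∈ M, x i * y (i + 1)) *
      ∏ i ∈ (M.biUnion fun i => {i, i + 1})ᶜ, (x i + y i) = ∏ i, x i + ∏ i, y i := by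
  have hone : (1 : Fin (N + 1)) ≠ 0 := by
    intro h
    have := congrArg Fin.val h
    simp [Nat.mod_eq_of_lt (show 1 < N + 1 by omega)] at this
  have hsucc : ∀ i : Fin (N + 1), i + 1 ≠ i := fun i h => hone (by simpa using h)
  set f : Finset (Fin (N + 1)) → Fin (N + 1) → ℂ :=
    fun M i => if i - 1 ∈ M then 0 else x i with hf
  set g : Finset (Fin (N + 1)) → Fin (N + 1) → ℂ :=
    fun M i => if i ∈ M then 0 else y i with hg
  have hmatch : ∀ M : Finset (Fin (N + 1)), M ∈ cycleMatchings (N + 1) ↔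
      ∀ i ∈ M, i + 1 ∉ M := by
    intro M
    simp only [cycleMatchings, mem_filter, mem_univ, true_and]
    constructor
    · intro h i hi hi1
      have := h i hi (i + 1) hi1 (hsucc i).symm
      have hmem : i + 1 ∈ ({i, i + 1} ∩ {i + 1, i + 1 + 1} : Finset (Fin (N + 1))) := by simp
      rw [this] at hmem
      simp at hmem
    · intro h i hi j hj hij
      ext k
      simp only [mem_inter, mem_insert, mem_singleton, notMem_empty, iff_false, not_and, not_or]
      rintro (rfl | rfl)
      · exact ⟨hij, fun h' => h j hj (h' ▸ hi)⟩
      · exact ⟨fun h' => h i hi (h' ▸ hj), fun h' => hij (add_right_cancel h')⟩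
  have hterm : ∀ M ∈ cycleMatchings (N + 1),
      (∏ i ∈ M, x i * y (i + 1)) * ∏ i ∈ (M.biUnion fun i => {i, i + 1})ᶜ, (x i + y i) =
        ∏ i, (f M i + g M i) := by
    intro M hM
    have hM' := (hmatch M).1 hM
    rw [← prod_mul_prod_compl (M.biUnion fun i => {i, i + 1}) (fun i => f M i + g M i)]
    congr 1
    · rw [prod_biUnion]
      · refine prod_congr rfl fun i hi => ?_
        rw [prod_pair (hsucc i).symm]
        have h1 : i - 1 ∉ M := fun h => hM' _ h (by simpa using hi)
        simp [hf, hg, hi, h1, hM' i hi]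
      · intro i hi j hj hij
        rw [Function.onFun, disjoint_iff_inter_eq_empty]
        exact (mem_filter.1 hM).2 i hi j hj hij
    · refine prod_congr rfl fun i hi => ?_
      simp only [mem_compl, mem_biUnion, mem_insert, mem_singleton, not_exists, not_and,
        not_or] at hi
      have h1 : i ∉ M := fun h => (hi i h).1 rfl
      have h2 : i - 1 ∉ M := fun h => (hi _ h).2 (by simp)
      simp [hf, hg, h1, h2]
  have hzero : ∀ M ∉ cycleMatchings (N + 1), ∏ i, (f M i + g M i) = 0 := by
    intro M hM
    rw [hmatch] at hM
    push Not at hM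
    obtain ⟨i, hi, hi1⟩ := hM
    exact prod_eq_zero (mem_univ (i + 1)) (by simp [hf, hg, hi, hi1])
  let D : Finset (Fin (N + 1)) → Finset (Fin (N + 1)) :=
    fun A => univ.filter fun i => i ∈ A ∧ i + 1 ∉ A
  have hweight : ∀ M A : Finset (Fin (N + 1)),
      (∏ i ∈ A, f M i) * ∏ i ∈ univ \ A, g M i =
        if M ∈ (D A).powerset then (∏ i ∈ A, x i) * ∏ i ∈ univ \ A, y i else 0 := by
    intro M A
    split_ifs with h
    · rw [mem_powerset] at h
      congr 1
      · refine prod_congr rfl fun i hi => if_neg fun hM => ?_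
        have := (mem_filter.1 (h hM)).2.2
        exact this (by simpa using hi)
      · refine prod_congr rfl fun i hi => if_neg fun hM => ?_
        exact (mem_sdiff.1 hi).2 (mem_filter.1 (h hM)).2.1
    · rw [mem_powerset, not_subset] at h
      obtain ⟨i, hi, hiD⟩ := h
      by_cases hA : i ∈ A
      · have hA1 : i + 1 ∈ A := by
          by_contra hc
          exact hiD (mem_filter.2 ⟨mem_univ _, hA, hc⟩)
        rw [prod_eq_zero hA1 (by simp [hf, hi]), zero_mul]
      · rw [prod_eq_zero (s := univ \ A) (i := i) (by simp [hA]) (by simp [hg, hi]), mul_zero]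
  have hD : ∀ A, D A = ∅ ↔ A = ∅ ∨ A = univ := by
    intro A
    constructor
    · intro h
      refine eq_empty_or_univ_of_succ_mem A fun i hi => ?_
      by_contra hc
      have : i ∈ D A := mem_filter.2 ⟨mem_univ _, hi, hc⟩
      rw [h] at this
      simp at this
    · rintro (rfl | rfl) <;> simp [D]
  have halt : ∀ A : Finset (Fin (N + 1)),
      ∑ M ∈ (D A).powerset, (-1 : ℂ) ^ M.card = if D A = ∅ then 1 else 0 := by
    intro A
    have := sum_powerset_neg_one_pow_card (x := D A)
    exact_mod_cast congrArg (Int.cast : ℤ → ℂ) this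
  calc _ = ∑ M ∈ cycleMatchings (N + 1), (-1 : ℂ) ^ M.card * ∏ i, (f M i + g M i) :=
        sum_congr rfl fun M hM => by rw [mul_assoc, hterm M hM]
    _ = ∑ M, (-1 : ℂ) ^ M.card * ∏ i, (f M i + g M i) :=
        sum_subset (subset_univ _) fun M _ hM => by rw [hzero M hM, mul_zero]
    _ = ∑ M : Finset (Fin (N + 1)), ∑ A : Finset (Fin (N + 1)),
          if M ∈ (D A).powerset then
            (-1 : ℂ) ^ M.card * ((∏ i ∈ A, x i) * ∏ i ∈ univ \ A, y i) else 0 := by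
        refine sum_congr rfl fun M _ => ?_
        rw [prod_add, mul_sum, powerset_univ]
        refine sum_congr rfl fun A _ => ?_
        rw [hweight, mul_ite, mul_zero]
    _ = ∑ A : Finset (Fin (N + 1)),
          if A = ∅ ∨ A = univ then (∏ i ∈ A, x i) * ∏ i ∈ univ \ A, y i else 0 := by
        rw [sum_comm]
        refine sum_congr rfl fun A _ => ?_
        rw [sum_ite_mem, univ_inter, ← sum_mul, halt]
        simp only [hD, ite_mul, one_mul, zero_mul]
    _ = ∑ A ∈ ({univ, ∅} : Finset (Finset (Fin (N + 1)))),
          (∏ i ∈ A, x i) * ∏ i ∈ univ \ A, y i := by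
        rw [← sum_filter]
        refine sum_congr ?_ fun _ _ => rfl
        ext A
        simp [or_comm]
    _ = _ := by
        rw [sum_pair univ_nonempty.ne_empty]
        simp

/-- The quadratic form of a matrix in the cone of the cycle. -/
lemma cyclePos_of_posDef {N : ℕ} (hN : 2 ≤ N) (S : Matrix (Fin (N + 1)) (Fin (N + 1)) ℝ)
    (hS : S ∈ cyclePSDCone (N + 1)) (hpd : S.PosDef) :
    CyclePos (fun i => S i i) (fun i => S i (i + 1)) := by
  intro v hv
  have hone : (1 : Fin (N + 1)) ≠ 0 := by
    intro h
    have := congrArg Fin.val h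
    simp [Nat.mod_eq_of_lt (show 1 < N + 1 by omega)] at this
  have htwo : (1 : Fin (N + 1)) + 1 ≠ 0 := by
    intro h
    have := congrArg Fin.val h
    simp [Fin.val_add, Nat.mod_eq_of_lt (show 1 < N + 1 by omega),
      Nat.mod_eq_of_lt (show 2 < N + 1 by omega)] at this
  have hrow : ∀ i, ∑ j, S i j * v j =
      S i i * v i + (S i (i + 1) * v (i + 1) + S i (i - 1) * v (i - 1)) := by
    intro i
    have h1 : i ≠ i + 1 := fun h => hone (by simpa using h.symm)
    have h2 : i ≠ i - 1 := fun h => hone (by simpa using h.symm)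
    have h3 : i + 1 ≠ i - 1 := fun h => htwo (by
      have h' := congrArg (fun k => k - i + 1) h
      simpa [sub_sub] using h')
    rw [← sum_subset (subset_univ ({i, i + 1, i - 1} : Finset (Fin (N + 1))))]
    · rw [sum_insert (by simp [h1, h2]), sum_pair h3]
    · intro j _ hj
      simp only [mem_insert, mem_singleton, not_or] at hj
      rw [hS.2 i j (Ne.symm hj.1) hj.2.1 (fun h => hj.2.2 (by rw [h]; simp)), zero_mul]
  have hsymm : ∀ i j, S i j = S j i := fun i j => by
    simpa using hpd.1.apply j i
  have hQ := hpd.dotProduct_mulVec_pos hv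
  have hshift : ∑ i, v i * (S i (i - 1) * v (i - 1)) = ∑ i, S i (i + 1) * v i * v (i + 1) := by
    rw [← Equiv.sum_comp (Equiv.addRight (1 : Fin (N + 1)))]
    refine sum_congr rfl fun i _ => ?_
    simp only [Equiv.coe_addRight, add_sub_cancel_right]
    rw [hsymm (i + 1) i]
    ring
  have hform : star v ⬝ᵥ S *ᵥ v =
      ∑ i, S i i * v i ^ 2 + 2 * ∑ i, S i (i + 1) * v i * v (i + 1) := by
    simp only [dotProduct, mulVec, hrow, Pi.star_apply, star_trivial, mul_add, sum_add_distrib,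
      hshift]
    rw [two_mul]
    refine congrArg₂ _ (sum_congr rfl fun i _ => by ring)
      (congrArg₂ _ (sum_congr rfl fun i _ => by ring) rfl)
  rwa [hform] at hQ

/-- Complex numbers with real sum `t` and product `P ^ 2`, where `2 * |P| ≤ t`, are real. -/
lemma im_eq_zero_of_add_of_mul {z w : ℂ} {t P : ℝ} (hadd : z + w = t)
    (hmul : z * w = (P : ℂ) ^ 2) (hP : 0 ≤ P) (ht : 2 * P ≤ t) : z.im = 0 := by
  by_contra hz
  rw [← Complex.ofReal_pow] at hmul
  have h1 := congrArg Complex.re hadd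
  have h2 := congrArg Complex.im hadd
  have h3 := congrArg Complex.re hmul
  have h4 := congrArg Complex.im hmul
  simp only [Complex.add_re, Complex.add_im, Complex.mul_re, Complex.mul_im, Complex.ofReal_re,
    Complex.ofReal_im] at h1 h2 h3 h4
  have hw : w.im = -z.im := by linarith
  have hre : w.re = z.re := by
    rw [hw] at h4
    apply mul_left_cancel₀ hz
    linarith
  rw [hw, hre] at h3
  have : 0 < z.im ^ 2 := by positivity
  nlinarith

lemma im_eq_zero_of_sq_nonneg {z : ℂ} (him : (z ^ 2).im = 0) (hre : 0 ≤ (z ^ 2).re) :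
    z.im = 0 := by
  by_contra hz
  simp only [sq, Complex.mul_re, Complex.mul_im] at him hre
  have h0 : z.re = 0 := by
    apply mul_left_cancel₀ hz
    linarith
  have : 0 < z.im ^ 2 := by positivity
  rw [h0] at hre
  nlinarith

/-- if a positive definite `Σ ∈ S⪰0^m(C_m)` satisfies the
matching-sum inequality, then every complex solution of the system
`γ_{i,i−1}² + γ_{i,i+1}² = σ_ii` and `γ_{i−1,i} γ_{i,i−1} = σ_{i−1,i}`
(indices modulo `m`) is real.  Here `(g i).1 = γ_{i,i−1}` and
`(g i).2 = γ_{i,i+1}`. -/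
theorem complex_solutions_are_real (m : ℕ) [NeZero m] (hm : 3 ≤ m)
    (S : Matrix (Fin m) (Fin m) ℝ) (hS : S ∈ cyclePSDCone m) (hpd : S.PosDef)
    (hineq : 2 * ∏ i : Fin m, |S i (i + 1)| ≤ matchingSum S)
    (g : Fin m → ℂ × ℂ)
    (heq1 : ∀ i : Fin m, (g i).1 ^ 2 + (g i).2 ^ 2 = ((S i i : ℝ) : ℂ))
    (heq2 : ∀ i : Fin m, (g (i - 1)).2 * (g i).1 = ((S (i - 1) i : ℝ) : ℂ)) :
    ∀ i : Fin m, ((g i).1).im = 0 ∧ ((g i).2).im = 0 := by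
  obtain ⟨N, rfl⟩ : ∃ N, m = N + 1 := ⟨m - 1, by omega⟩
  have hpos := cyclePos_of_posDef (by omega) S hS hpd
  have hsum : ∀ i, (g i).2 ^ 2 + (g i).1 ^ 2 = ((S i i : ℝ) : ℂ) := fun i => by
    rw [add_comm, heq1]
  have hmul : ∀ i, (g i).2 ^ 2 * (g (i + 1)).1 ^ 2 = ((S i (i + 1) : ℝ) : ℂ) ^ 2 := fun i => by
    have h := heq2 (i + 1)
    rw [add_sub_cancel_right] at h
    rw [← mul_pow, h]
  suffices h : ∀ i, (((g i).2 ^ 2).im = 0 ∧ 0 ≤ ((g i).2 ^ 2).re) ∧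
      ((g i).1 ^ 2).im = 0 ∧ 0 ≤ ((g i).1 ^ 2).re from fun i =>
    ⟨im_eq_zero_of_sq_nonneg (h i).2.1 (h i).2.2, im_eq_zero_of_sq_nonneg (h i).1.1 (h i).1.2⟩
  by_cases hz : ∃ j, S j (j + 1) = 0
  · obtain ⟨j, hj⟩ := hz
    exact hpos.nonneg_of_edge_eq_zero (x := fun i => (g i).2 ^ 2) (y := fun i => (g i).1 ^ 2)
      hsum hmul hj
  push Not at hz
  have hadd : ∏ i, (g i).2 ^ 2 + ∏ i, (g i).1 ^ 2 = ((matchingSum S : ℝ) : ℂ) := by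
    rw [← matching_expansion_eq (by omega), matchingSum]
    push_cast
    simp only [hsum, hmul]
  have hprodmul : (∏ i, (g i).2 ^ 2) * ∏ i, (g i).1 ^ 2 =
      ((∏ i, |S i (i + 1)| : ℝ) : ℂ) ^ 2 := by
    rw [← Equiv.prod_comp (Equiv.addRight (1 : Fin (N + 1))) (fun i => (g i).1 ^ 2),
      ← prod_mul_distrib, ← Complex.ofReal_pow, ← prod_pow]
    simp only [Equiv.coe_addRight, hmul, sq_abs]
    push_cast
    rfl
  have hreal := im_eq_zero_of_add_of_mul hadd hprodmul
    (prod_nonneg fun i _ => abs_nonneg _) hineq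
  have hx := hpos.nonneg_of_prod_real (x := fun i => (g i).2 ^ 2) (y := fun i => (g i).1 ^ 2)
    hsum hmul hz hreal
  refine fun i => ⟨hx i, ?_⟩
  obtain ⟨hxi, hxr⟩ := hx (i - 1)
  have h := hmul (i - 1)
  rw [sub_add_cancel, ← Complex.ofReal_pow] at h
  have hne : S (i - 1) i ≠ 0 := by simpa using hz (i - 1)
  have h1 := congrArg Complex.im h
  have h2 := congrArg Complex.re h
  rw [Complex.mul_im, hxi, zero_mul, add_zero, Complex.ofReal_im] at h1
  rw [Complex.mul_re, hxi, zero_mul, sub_zero, Complex.ofReal_re] at h2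
  have hxr' : 0 < ((g (i - 1)).2 ^ 2).re := by
    refine lt_of_le_of_ne hxr fun h0 => ?_
    rw [← h0, zero_mul] at h2
    exact pow_ne_zero 2 hne h2.symm
  exact ⟨(mul_eq_zero.1 h1).resolve_left hxr'.ne',
    nonneg_of_mul_nonneg_right (h2 ▸ sq_nonneg _) hxr'⟩
end
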